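/- arXiv:2306.06375 — 2 statements merged into one kernel-verified Lean document; each statement's English description precedes it below -/
import Mathlib

section
/- Let P ∈ ℝ^{N×N} be symmetric positive definite, ρ ∈ (0,1), and let z^k, z^{k,⋆} ∈ ℝ^N (k = 1,…,K) be sequences satisfying ‖z^{k+1} − z^{k,⋆}‖_P ≤ ρ·‖z^k − z^{k,⋆}‖_P for all 1 ≤ k ≤ K−1. Then Σ_{k=1}^K ‖z^k − z^{k,⋆}‖_P ≤ ( ‖z^1 − z^{1,⋆}‖_P + W_K ) / (1 − ρ), where W_K := Σ_{k=2}^K ‖z^{k,⋆} − z^{k−1,⋆}‖_P. -/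
open Matrix Finset

/-- The `P`-norm `‖v‖_P = √(vᵀ P v)`. -/
noncomputable def Pnorm {ι : Type*} [Fintype ι] (P : Matrix ι ι ℝ) (v : ι → ℝ) : ℝ :=
  Real.sqrt (v ⬝ᵥ P.mulVec v)

/-- The Euclidean norm of a finitely supported real vector. -/
noncomputable def vnorm {ι : Type*} [Fintype ι] (v : ι → ℝ) : ℝ :=
  Real.sqrt (v ⬝ᵥ v)

/-- Smallest eigenvalue of a hermitian (real symmetric) matrix. -/
noncomputable def lamMin {ι : Type*} [Fintype ι] [DecidableEq ι]
    (P : Matrix ι ι ℝ) (hP : P.IsHermitian) : ℝ := ⨅ i, hP.eigenvalues i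

/-- Largest eigenvalue of a hermitian (real symmetric) matrix. -/
noncomputable def lamMax {ι : Type*} [Fintype ι] [DecidableEq ι]
    (P : Matrix ι ι ℝ) (hP : P.IsHermitian) : ℝ := ⨆ i, hP.eigenvalues i

theorem Pnorm_nonneg {ι : Type*} [Fintype ι] (P : Matrix ι ι ℝ) (v : ι → ℝ) :
    0 ≤ Pnorm P v :=
  Real.sqrt_nonneg _

theorem Pnorm_add_le {ι : Type*} [Fintype ι] {P : Matrix ι ι ℝ} (hP : P.PosSemidef)
    (u v : ι → ℝ) : Pnorm P (u + v) ≤ Pnorm P u + Pnorm P v := by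
  let core : PreInnerProductSpace.Core ℝ (ι → ℝ) :=
    { inner := fun x y => x ⬝ᵥ P *ᵥ y
      conj_inner_symm := fun x y => by
        have hT : Pᵀ = P := by simpa using hP.isHermitian.eq
        rw [conj_trivial, dotProduct_mulVec, ← mulVec_transpose, hT, dotProduct_comm]
      re_inner_nonneg := fun x => by simpa using hP.dotProduct_mulVec_nonneg x
      add_left := fun x y z => add_dotProduct x y (P *ᵥ z)
      smul_left := fun x y r => smul_dotProduct r x (P *ᵥ y) }
  let seminorm : SeminormedAddCommGroup (ι → ℝ) :=
    @InnerProductSpace.Core.toSeminormedAddCommGroup ℝ _ _ _ _ core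
  exact @norm_add_le _ seminorm.toSeminormedAddGroup u v

/-- A nonnegative sequence that contracts by `ρ` up to perturbations `w k` has its partial sums
controlled by the initial value and the total perturbation. -/
theorem sum_Icc_le_of_le_mul_add {a w : ℕ → ℝ} {ρ : ℝ} (hρ0 : 0 ≤ ρ) (hρ1 : ρ < 1)
    (ha : ∀ k, 0 ≤ a k) {n : ℕ}
    (h : ∀ k, 1 ≤ k → k ≤ n → a (k + 1) ≤ ρ * a k + w (k + 1)) :
    ∑ k ∈ Icc 1 (n + 1), a k ≤ (a 1 + ∑ k ∈ Icc 2 (n + 1), w k) / (1 - ρ) := by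
  have key : (1 - ρ) * ∑ k ∈ Icc 1 (n + 1), a k + ρ * a (n + 1) ≤
      a 1 + ∑ k ∈ Icc 2 (n + 1), w k := by
    induction n with
    | zero => simp; linarith
    | succ n ih =>
      rw [sum_Icc_succ_top (by omega) a, sum_Icc_succ_top (by omega) w]
      linarith [ih fun k hk hkn => h k hk (by omega), h (n + 1) (by omega) le_rfl]
  rw [le_div_iff₀ (sub_pos.2 hρ1)]
  linarith [mul_nonneg hρ0 (ha (n + 1))]

/-- **Lemma 4, first inequality (eq. (29)).** Under the contraction hypothesis,
`Σ_{k=1}^K ‖z^k - z^{k,⋆}‖_P ≤ (‖z^1 - z^{1,⋆}‖_P + W_K)/(1 - ρ)`, with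
`W_K = Σ_{k=2}^K ‖z^{k,⋆} - z^{k-1,⋆}‖_P`. -/
theorem cumulative_error_bound {N : ℕ}
    (P : Matrix (Fin N) (Fin N) ℝ) (hP : P.PosDef)
    (ρ : ℝ) (hρ0 : 0 < ρ) (hρ1 : ρ < 1) (K : ℕ)
    (z zs : ℕ → Fin N → ℝ)
    (hcontract : ∀ k, 1 ≤ k → k ≤ K - 1 →
      Pnorm P (z (k + 1) - zs k) ≤ ρ * Pnorm P (z k - zs k)) :
    ∑ k ∈ Finset.Icc 1 K, Pnorm P (z k - zs k) ≤
      (Pnorm P (z 1 - zs 1) + ∑ k ∈ Finset.Icc 2 K, Pnorm P (zs k - zs (k - 1)))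
        / (1 - ρ) := by
  cases K with
  | zero =>
    simpa using div_nonneg (Pnorm_nonneg P (z 1 - zs 1)) (sub_pos.2 hρ1).le
  | succ n =>
    refine sum_Icc_le_of_le_mul_add (a := fun k => Pnorm P (z k - zs k))
      (w := fun k => Pnorm P (zs k - zs (k - 1))) hρ0.le hρ1 (fun k => Pnorm_nonneg P _) ?_
    intro k hk hkn
    have symm : Pnorm P (zs k - zs (k + 1)) = Pnorm P (zs (k + 1) - zs k) := by
      rw [← neg_sub, Pnorm, Pnorm, mulVec_neg, neg_dotProduct_neg]
    have triangle := Pnorm_add_le hP.posSemidef (z (k + 1) - zs k) (zs k - zs (k + 1))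
    rw [sub_add_sub_cancel, symm] at triangle
    simpa using triangle.trans (add_le_add_left (hcontract k hk (by simpa using hkn)) _)
end

section
/- Let P ∈ ℝ^{N×N} be symmetric positive definite, ρ ∈ (0,1), L > 0. For each k = 1,…,K let f^k : ℝ^d → ℝ be differentiable and L-smooth with ∇f^k(x^{k,⋆}) = 0, let x_j^k ∈ ℝ^d for j = 1,…,n, and let z^k, z^{k,⋆} ∈ ℝ^N satisfy: (i) ‖z^{k+1} − z^{k,⋆}‖_P ≤ ρ·‖z^k − z^{k,⋆}‖_P for all k; (ii) ‖x̲^k − x̲^{k,⋆}‖ ≤ ‖z^{k+1} − z^{k,⋆}‖, where x̲^k := (x_1^k,…,x_n^k) and x̲^{k,⋆} := (x^{k,⋆},…,x^{k,⋆}) in ℝ^{nd}. Then the dynamic regret satisfies Reg^K := (1/n)·Σ_{j=1}^n Σ_{k=1}^K (f^k(x_j^k) − f^k(x^{k,⋆})) ≤ (2Lρ²/(n·λ_min(P)·(1 − ρ²)²)) · ( ‖z^1 − z^{1,⋆}‖_P² + W_{K,2} ), where W_{K,2} := Σ_{k=2}^K ‖z^{k,⋆} − z^{k−1,⋆}‖_P².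 -/
open Matrix Finset

theorem sub_le_of_gradient_lipschitz {E : Type*} [NormedAddCommGroup E] [InnerProductSpace ℝ E]
    [CompleteSpace E] {f : E → ℝ} {L : ℝ} (hf : Differentiable ℝ f)
    (hL : ∀ w v : E, ‖gradient f w - gradient f v‖ ≤ L * ‖w - v‖)
    {a : E} (ha : gradient f a = 0) (y : E) :
    f y - f a ≤ L / 2 * ‖y - a‖ ^ 2 := by
  have hderiv : ∀ t : ℝ, HasDerivAt (fun t : ℝ => f (a + t • (y - a)) - L / 2 * ‖y - a‖ ^ 2 * t ^ 2)
      (inner ℝ (gradient f (a + t • (y - a))) (y - a) - L / 2 * ‖y - a‖ ^ 2 * (2 * t)) t := by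
    intro t
    have hline : HasDerivAt (fun t : ℝ => a + t • (y - a)) (y - a) t := by
      simpa using ((hasDerivAt_id t).smul_const (y - a)).const_add a
    have hcomp := (hf (a + t • (y - a))).hasGradientAt.hasFDerivAt.comp_hasDerivAt t hline
    exact (hcomp.sub ((hasDerivAt_pow 2 t).const_mul (L / 2 * ‖y - a‖ ^ 2))).congr_deriv (by simp)
  have hanti : AntitoneOn (fun t : ℝ => f (a + t • (y - a)) - L / 2 * ‖y - a‖ ^ 2 * t ^ 2)
      (Set.Icc 0 1) := by
    refine antitoneOn_of_deriv_nonpos (convex_Icc 0 1)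
      (fun t _ => (hderiv t).continuousAt.continuousWithinAt)
      (fun t _ => (hderiv t).differentiableAt.differentiableWithinAt) fun t ht => ?_
    rw [interior_Icc] at ht
    rw [(hderiv t).deriv]
    have hgrad : ‖gradient f (a + t • (y - a))‖ ≤ L * (t * ‖y - a‖) := by
      simpa [ha, norm_smul, abs_of_pos ht.1] using hL (a + t • (y - a)) a
    have hinner := (real_inner_le_norm (gradient f (a + t • (y - a))) (y - a)).trans
      (mul_le_mul_of_nonneg_right hgrad (norm_nonneg (y - a)))
    linarith
  have := hanti (Set.left_mem_Icc.2 zero_le_one) (Set.right_mem_Icc.2 zero_le_one) zero_le_one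
  simp only [one_smul, add_sub_cancel, zero_smul, add_zero] at this
  linarith

theorem Pnorm_sq {ι : Type*} [Fintype ι] {P : Matrix ι ι ℝ} (hP : P.PosSemidef) (v : ι → ℝ) :
    Pnorm P v ^ 2 = v ⬝ᵥ P.mulVec v :=
  Real.sq_sqrt (by simpa using hP.dotProduct_mulVec_nonneg v)

theorem mul_Pnorm_sub_sq_le {ι : Type*} [Fintype ι] {P : Matrix ι ι ℝ} (hP : P.PosSemidef)
    (r : ℝ) (u w : ι → ℝ) :
    r * (1 - r) * Pnorm P (u - w) ^ 2 ≤ (1 - r) * Pnorm P u ^ 2 + r * Pnorm P w ^ 2 := by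
  have h : 0 ≤ ((1 - r) • u + r • w) ⬝ᵥ P.mulVec ((1 - r) • u + r • w) := by
    simpa using hP.dotProduct_mulVec_nonneg ((1 - r) • u + r • w)
  simp only [Pnorm_sq hP, mulVec_add, mulVec_sub, mulVec_smul, add_dotProduct, sub_dotProduct,
    dotProduct_add, dotProduct_sub, smul_dotProduct, dotProduct_smul, smul_eq_mul] at h ⊢
  linarith

theorem lamMin_mul_dotProduct_le {ι : Type*} [Fintype ι] [DecidableEq ι] {P : Matrix ι ι ℝ}
    (hP : P.IsHermitian) (v : ι → ℝ) :
    lamMin P hP * (v ⬝ᵥ v) ≤ v ⬝ᵥ P.mulVec v := by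
  let c : ι → ℝ := fun i => inner ℝ (WithLp.toLp 2 v) (hP.eigenvectorBasis i)
  have hc : ∀ i, inner ℝ (hP.eigenvectorBasis i) (WithLp.toLp 2 v) = c i := fun i =>
    real_inner_comm _ _
  have hPc : ∀ i, inner ℝ (hP.eigenvectorBasis i) (WithLp.toLp 2 (P.mulVec v)) =
      hP.eigenvalues i * c i := by
    intro i
    have hsymm : Pᵀ = P := by simpa [IsHermitian, conjTranspose_eq_transpose_of_trivial] using hP
    simp only [c, EuclideanSpace.inner_eq_star_dotProduct, star_trivial]
    rw [dotProduct_comm, dotProduct_mulVec, ← mulVec_transpose, hsymm,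
      hP.mulVec_eigenvectorBasis, smul_dotProduct, smul_eq_mul]
  have hsq : v ⬝ᵥ v = ∑ i, c i * c i := by
    have := hP.eigenvectorBasis.sum_inner_mul_inner (WithLp.toLp 2 v) (WithLp.toLp 2 v)
    simp only [hc, EuclideanSpace.inner_toLp_toLp, star_trivial] at this
    exact this.symm
  have hquad : v ⬝ᵥ P.mulVec v = ∑ i, c i * (hP.eigenvalues i * c i) := by
    have := hP.eigenvectorBasis.sum_inner_mul_inner (WithLp.toLp 2 v) (WithLp.toLp 2 (P.mulVec v))
    simp only [hPc] at this
    rw [dotProduct_comm]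
    simpa [EuclideanSpace.inner_toLp_toLp] using this.symm
  rw [hsq, hquad, Finset.mul_sum]
  refine Finset.sum_le_sum fun i _ => ?_
  have hi : lamMin P hP ≤ hP.eigenvalues i := ciInf_le (Set.finite_range _).bddBelow i
  nlinarith [mul_le_mul_of_nonneg_right hi (mul_self_nonneg (c i))]

theorem lamMin_pos {ι : Type*} [Fintype ι] [DecidableEq ι] [Nonempty ι] {P : Matrix ι ι ℝ}
    (hP : P.PosDef) : 0 < lamMin P hP.1 := by
  obtain ⟨i, hi⟩ := exists_eq_ciInf_of_finite (f := hP.1.eigenvalues)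
  rw [lamMin, ← hi]
  exact hP.eigenvalues_pos i

theorem sum_le_of_perturbed_contraction {A W : ℕ → ℝ} {r : ℝ} (hr1 : r < 1) (hr0 : 0 ≤ r)
    (hA : ∀ k, 0 ≤ A k)
    (hstep : ∀ k, (1 - r) * A (k + 1) ≤ (1 - r) * r * A k + W (k + 1)) (K : ℕ) :
    (1 - r) ^ 2 * ∑ k ∈ Finset.Icc 1 K, A k ≤ A 1 + ∑ k ∈ Finset.Icc 2 K, W k := by
  rcases Nat.eq_zero_or_pos K with rfl | hK
  · simpa using hA 1
  have hr : 0 ≤ 1 - r := by linarith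
  suffices h : (1 - r) ^ 2 * ∑ k ∈ Finset.Icc 1 K, A k + (1 - r) * r * A K ≤
      A 1 + ∑ k ∈ Finset.Icc 2 K, W k by
    have := mul_nonneg (mul_nonneg hr hr0) (hA K)
    linarith
  induction K, hK using Nat.le_induction with
  | base =>
    simp
    nlinarith [mul_nonneg hr0 (hA 1)]
  | succ m hm ih =>
    rw [Finset.sum_Icc_succ_top (by omega), Finset.sum_Icc_succ_top (by omega)]
    linarith [hstep m]

/-- **Theorem 2.** Under smoothness, `∇f^k(x^{k,⋆}) = 0`, the contraction (i), and
the sub-block bound (ii), the dynamic regret satisfies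
`Reg^K ≤ (2Lρ²/(n·λ_min(P)(1-ρ²)²))·(‖z^1 - z^{1,⋆}‖_P² + W_{K,2})`. -/
theorem ggt_dynamic_regret_squared {N d n : ℕ}
    (P : Matrix (Fin N) (Fin N) ℝ) (hP : P.PosDef)
    (ρ L : ℝ) (hρ0 : 0 < ρ) (hρ1 : ρ < 1) (hL : 0 < L) (K : ℕ)
    (f : ℕ → EuclideanSpace ℝ (Fin d) → ℝ)
    (xs : ℕ → EuclideanSpace ℝ (Fin d))
    (x : ℕ → Fin n → EuclideanSpace ℝ (Fin d))
    (hdiff : ∀ k, Differentiable ℝ (f k))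
    (hsmooth : ∀ k, ∀ w v : EuclideanSpace ℝ (Fin d),
      ‖gradient (f k) w - gradient (f k) v‖ ≤ L * ‖w - v‖)
    (hgrad0 : ∀ k, gradient (f k) (xs k) = 0)
    (z zs : ℕ → Fin N → ℝ)
    (hcontract : ∀ k, Pnorm P (z (k + 1) - zs k) ≤ ρ * Pnorm P (z k - zs k))
    (hsub : ∀ k, Real.sqrt (∑ j : Fin n, ‖x k j - xs k‖ ^ 2) ≤
      vnorm (z (k + 1) - zs k)) :
    (1 / (n : ℝ)) * ∑ j : Fin n, ∑ k ∈ Finset.Icc 1 K, (f k (x k j) - f k (xs k)) ≤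
      2 * L * ρ ^ 2 / (n * lamMin P hP.1 * (1 - ρ ^ 2) ^ 2) *
        ((Pnorm P (z 1 - zs 1)) ^ 2
          + ∑ k ∈ Finset.Icc 2 K, (Pnorm P (zs k - zs (k - 1))) ^ 2) := by
  have hPs := hP.posSemidef
  have hcontract_sq : ∀ k,
      Pnorm P (z (k + 1) - zs k) ^ 2 ≤ ρ ^ 2 * Pnorm P (z k - zs k) ^ 2 := fun k => by
    rw [← mul_pow]
    exact pow_le_pow_left₀ (Real.sqrt_nonneg _) (hcontract k) 2
  have hstep : ∀ k, (1 - ρ) * Pnorm P (z (k + 1) - zs (k + 1)) ^ 2 ≤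
      (1 - ρ) * ρ * Pnorm P (z k - zs k) ^ 2 + Pnorm P (zs (k + 1) - zs k) ^ 2 := by
    intro k
    have h := mul_Pnorm_sub_sq_le hPs ρ (z (k + 1) - zs k) (zs (k + 1) - zs k)
    rw [sub_sub_sub_cancel_right] at h
    have := mul_le_mul_of_nonneg_left (hcontract_sq k) (sub_nonneg.2 hρ1.le)
    refine le_of_mul_le_mul_left ?_ hρ0
    linarith
  have htrack := sum_le_of_perturbed_contraction (A := fun k => Pnorm P (z k - zs k) ^ 2)
    (W := fun k => Pnorm P (zs k - zs (k - 1)) ^ 2) hρ1 hρ0.le (fun k => sq_nonneg _)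
    hstep K
  set B := Pnorm P (z 1 - zs 1) ^ 2 + ∑ k ∈ Finset.Icc 2 K, Pnorm P (zs k - zs (k - 1)) ^ 2
  have hB : 0 ≤ B := add_nonneg (sq_nonneg _) (Finset.sum_nonneg fun k _ => sq_nonneg _)
  have hround : ∀ k, ∑ j : Fin n, (f k (x k j) - f k (xs k)) ≤
      L / 2 * ((z (k + 1) - zs k) ⬝ᵥ (z (k + 1) - zs k)) := by
    intro k
    have hsq := (Real.sqrt_le_sqrt_iff
      (by simpa using dotProduct_star_self_nonneg (z (k + 1) - zs k))).1 (hsub k)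
    calc ∑ j : Fin n, (f k (x k j) - f k (xs k))
        ≤ ∑ j : Fin n, L / 2 * ‖x k j - xs k‖ ^ 2 := Finset.sum_le_sum fun j _ =>
          sub_le_of_gradient_lipschitz (hdiff k) (hsmooth k) (hgrad0 k) _
      _ = L / 2 * ∑ j : Fin n, ‖x k j - xs k‖ ^ 2 := by rw [Finset.mul_sum]
      _ ≤ _ := mul_le_mul_of_nonneg_left hsq (by positivity)
  rw [Finset.sum_comm]
  rcases Nat.eq_zero_or_pos N with rfl | hN
  · have hle : ∑ k ∈ Finset.Icc 1 K, ∑ j : Fin n, (f k (x k j) - f k (xs k)) ≤ 0 :=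
      Finset.sum_nonpos fun k _ => by simpa using hround k
    simpa [lamMin] using mul_nonpos_of_nonneg_of_nonpos (by positivity : 0 ≤ (n : ℝ)⁻¹) hle
  have : Nonempty (Fin N) := ⟨⟨0, hN⟩⟩
  have hlam := lamMin_pos hP
  set l := lamMin P hP.1
  have hr : 0 < 1 - ρ := sub_pos.2 hρ1
  have hregret : ∑ k ∈ Finset.Icc 1 K, ∑ j : Fin n, (f k (x k j) - f k (xs k)) ≤
      L / 2 * (ρ ^ 2 / l) * ∑ k ∈ Finset.Icc 1 K, Pnorm P (z k - zs k) ^ 2 := by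
    rw [Finset.mul_sum]
    refine Finset.sum_le_sum fun k _ => (hround k).trans ?_
    rw [mul_assoc]
    refine mul_le_mul_of_nonneg_left ?_ (by positivity)
    have hsq := hcontract_sq k
    rw [Pnorm_sq hPs] at hsq
    rw [div_mul_eq_mul_div, le_div_iff₀ hlam, mul_comm]
    exact (lamMin_mul_dotProduct_le hP.1 _).trans hsq
  have hsum : ∑ k ∈ Finset.Icc 1 K, Pnorm P (z k - zs k) ^ 2 ≤ 4 / (1 - ρ ^ 2) ^ 2 * B := by
    have hden : 0 < 1 - ρ ^ 2 := by nlinarith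
    rw [div_mul_eq_mul_div, le_div_iff₀ (by positivity)]
    have hfour : (1 + ρ) ^ 2 ≤ 4 := by nlinarith
    have h₁ := mul_le_mul_of_nonneg_left htrack (sq_nonneg (1 + ρ))
    have h₂ := mul_le_mul_of_nonneg_right hfour hB
    linarith
  calc _ ≤ 1 / (n : ℝ) * (L / 2 * (ρ ^ 2 / l) * (4 / (1 - ρ ^ 2) ^ 2 * B)) := by
        refine mul_le_mul_of_nonneg_left (hregret.trans ?_) (by positivity)
        exact mul_le_mul_of_nonneg_left hsum (by positivity)
    _ = _ := by
        simp only [div_eq_mul_inv, mul_inv]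
        ring
end
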